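/- Let K be a field of characteristic zero and let D = x1·∂_{x2} − x2·∂_{x3} be the K-derivation of R = K[x1,x2,x3]. If f ∈ R satisfies f^i ∈ im D for all positive integers i, then deg_ω f < 0, where deg_ω denotes the weighted degree with weight vector ω = (−1,0,1). -/

import Mathlib

open MvPolynomial

/-- The weighted degree of a polynomial in `K[x₁,x₂,x₃]` with respect to the weight
vector `ω = (-1, 0, 1)`; it is `-∞` (i.e. `⊥`) on the zero polynomial. -/
noncomputable def degOmega {K : Type*} [Field K] (f : MvPolynomial (Fin 3) K) : WithBot ℤ :=
  f.support.sup fun β => ((-(β 0 : ℤ) + (β 2 : ℤ) : ℤ) : WithBot ℤ)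

/-- A monic polynomial over a number field has a power whose integral over `[0, 1]` is nonzero. -/
theorem exists_integral_pow_ne_zero_of_finiteDimensional {F : Type*} [Field F] [Algebra ℚ F]
    [FiniteDimensional ℚ F] {f : Polynomial F} (hf : f.Monic) :
    ∃ m > 0, ∑ k ∈ Finset.range (f.natDegree * m + 1),
      ((k : ℚ) + 1)⁻¹ • (f ^ m).coeff k ≠ 0 := by
  rcases Nat.eq_zero_or_pos f.natDegree with hd | hd
  · exact ⟨1, one_pos, by simp [hf.natDegree_eq_zero.mp hd]⟩
  obtain ⟨y, hy0, hy⟩ := exists_integral_multiples ℤ ℚ f.coeffs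
  obtain ⟨p, hp, hyp, hpd⟩ := Nat.exists_prime_gt_modEq_one y.natAbs hd.ne'
  obtain ⟨m, hm⟩ := (Nat.modEq_iff_dvd' hp.one_lt.le).mp hpd.symm
  have hpm : f.natDegree * m + 1 = p := by have := hp.one_lt; omega
  refine ⟨m, Nat.pos_of_ne_zero ?_, fun h => ?_⟩
  · rintro rfl
    exact hp.ne_one (by simpa using hpm.symm)
  let := Polynomial.algebra ℤ F
  have hint : ∀ k, IsIntegral ℤ ((y : F) ^ m * (f ^ m).coeff k) := by
    intro k
    have h1 : IsIntegral (Polynomial ℤ) (Polynomial.C (y : F) * f) := by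
      refine Polynomial.isIntegral_iff_isIntegral_coeff.mpr fun n => ?_
      by_cases hn : f.coeff n = 0
      · simp [hn, isIntegral_zero]
      · simpa using hy _ (Polynomial.coeff_mem_coeffs hn)
    have h2 := Polynomial.isIntegral_iff_isIntegral_coeff.mp (h1.pow m) k
    rwa [mul_pow, ← Polynomial.C_pow, Polynomial.coeff_C_mul] at h2
  set n := f.natDegree * m with hn
  rw [Finset.sum_range_succ] at h
  have hlead : (f ^ m).coeff n = 1 := by
    have h1 := hf.pow m
    rwa [Polynomial.Monic, Polynomial.leadingCoeff, hf.natDegree_pow, mul_comm] at h1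
  have hsum : IsIntegral ℤ ((n.factorial : F) * (y : F) ^ m *
      ∑ k ∈ Finset.range n, ((k : ℚ) + 1)⁻¹ • (f ^ m).coeff k) := by
    rw [Finset.mul_sum]
    refine IsIntegral.sum _ fun k hk => ?_
    obtain ⟨c, hc⟩ := Nat.dvd_factorial k.succ_pos (Finset.mem_range.mp hk)
    have hk0 : algebraMap ℚ F ((k : ℚ) + 1) ≠ 0 := by
      rw [Ne, map_eq_zero]; positivity
    have heq : (n.factorial : F) * (y : F) ^ m * (((k : ℚ) + 1)⁻¹ • (f ^ m).coeff k) =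
        (c : F) * ((y : F) ^ m * (f ^ m).coeff k) := by
      rw [Algebra.smul_def, hc, map_inv₀]
      push_cast [map_add, map_natCast, map_one] at hk0 ⊢
      field_simp
    rw [heq]
    have hc_int : IsIntegral ℤ (c : F) := by
      simpa using isIntegral_algebraMap (R := ℤ) (A := F) (x := (c : ℤ))
    exact hc_int.mul (hint k)
  have hrat : IsIntegral ℤ ((n.factorial * y ^ m / p : ℚ)) := by
    rw [← isIntegral_algebraMap_iff (algebraMap ℚ F).injective]
    have heq : algebraMap ℚ F (n.factorial * y ^ m / p) =
        -((n.factorial : F) * (y : F) ^ m *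
          ∑ k ∈ Finset.range n, ((k : ℚ) + 1)⁻¹ • (f ^ m).coeff k) := by
      rw [eq_neg_of_add_eq_zero_left h, hlead, Algebra.smul_def, ← hpm]
      push_cast [div_eq_mul_inv, map_mul, map_pow, map_inv₀, map_add, map_natCast,
        map_intCast, map_one]
      ring
    rw [heq]
    exact hsum.neg
  obtain ⟨z, hz⟩ := IsIntegrallyClosed.isIntegral_iff.mp hrat
  have hp0 : (p : ℚ) ≠ 0 := by exact_mod_cast hp.ne_zero
  rw [eq_div_iff hp0] at hz
  have hz' : z * p = n.factorial * y ^ m := by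
    rw [eq_intCast] at hz
    exact_mod_cast hz
  have hpZ := Nat.prime_iff_prime_int.mp hp
  rcases hpZ.dvd_or_dvd (hz' ▸ Dvd.intro_left z rfl) with h1 | h1
  · have := (hp.dvd_factorial).mp (Int.natCast_dvd_natCast.mp h1)
    omega
  · have := Nat.le_of_dvd (Int.natAbs_pos.mpr hy0) (Int.natCast_dvd.mp (hpZ.dvd_of_dvd_pow h1))
    omega

/-- A nonzero finitely generated `ℚ`-algebra maps to a number field. -/
theorem exists_algHom_finiteDimensional.{u} (B : Type u) [CommRing B] [Nontrivial B] [Algebra ℚ B]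
    [Algebra.FiniteType ℚ B] :
    ∃ (F : Type u) (_ : Field F) (_ : Algebra ℚ F) (_ : FiniteDimensional ℚ F),
      Nonempty (B →ₐ[ℚ] F) := by
  obtain ⟨M, hM⟩ := Ideal.exists_maximal B
  let := Ideal.Quotient.field M
  exact ⟨B ⧸ M, inferInstance, Ideal.Quotient.algebra ℚ,
    finite_of_finite_type_of_isJacobsonRing ℚ (B ⧸ M), ⟨Ideal.Quotient.mkₐ ℚ M⟩⟩

/-- A monic polynomial over a field of characteristic zero has a power whose integral over
`[0, 1]` is nonzero. -/
theorem exists_integral_pow_ne_zero {K : Type*} [Field K] [Algebra ℚ K]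
    {f : Polynomial K} (hf : f.Monic) :
    ∃ m > 0, ∑ k ∈ Finset.range (f.natDegree * m + 1),
      ((k : ℚ) + 1)⁻¹ • (f ^ m).coeff k ≠ 0 := by
  let B := Algebra.adjoin ℚ (f.coeffs : Set K)
  have hfin : Algebra.FiniteType ℚ B :=
    Subalgebra.fg_iff_finiteType _ |>.mp (Subalgebra.fg_adjoin_finset _)
  have hlift : f ∈ Polynomial.lifts (algebraMap B K) := by
    refine (Polynomial.lifts_iff_coeff_lifts _).mpr fun n => ?_
    by_cases hn : f.coeff n = 0
    · exact ⟨0, by simp [hn]⟩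
    · exact ⟨⟨_, Algebra.subset_adjoin (Polynomial.coeff_mem_coeffs hn)⟩, rfl⟩
  obtain ⟨g, hgf, hdeg, hg⟩ := Polynomial.lifts_and_natDegree_eq_and_monic hlift hf
  obtain ⟨F, _, _, _, ⟨φ⟩⟩ := exists_algHom_finiteDimensional B
  obtain ⟨m, hm, hne⟩ := exists_integral_pow_ne_zero_of_finiteDimensional
    (hg.map (φ : B →+* F))
  refine ⟨m, hm, fun h => hne ?_⟩
  have hB : ∑ k ∈ Finset.range (f.natDegree * m + 1), ((k : ℚ) + 1)⁻¹ • (g ^ m).coeff k = 0 := by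
    apply Subtype.val_injective
    have : ∀ k, (f ^ m).coeff k = B.val ((g ^ m).coeff k) := fun k => by
      rw [← hgf, ← Polynomial.map_pow, Polynomial.coeff_map]; rfl
    change B.val _ = B.val 0
    simpa [map_sum, this] using h
  rw [hg.natDegree_map, hdeg]
  simpa [map_sum, ← Polynomial.map_pow, Polynomial.coeff_map] using
    congrArg φ hB

/-- If all positive powers of `f` have integral zero over `[0, 1]`, then `f = 0`. -/
theorem eq_zero_of_forall_pow_eq_derivative {K : Type*} [Field K] [CharZero K]
    {f : Polynomial K} (hf : ∀ m > 0, ∃ Q : Polynomial K,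
      Polynomial.derivative Q = f ^ m ∧ Q.eval 0 = Q.eval 1) : f = 0 := by
  by_contra hf0
  let : Algebra ℚ K := DivisionRing.toRatAlgebra
  have hmonic := Polynomial.monic_mul_leadingCoeff_inv hf0
  obtain ⟨m, hm, hne⟩ := exists_integral_pow_ne_zero hmonic
  obtain ⟨Q, hQ, hQe⟩ := hf m hm
  refine hne ?_
  set c := f.leadingCoeff⁻¹ ^ m
  set n := (f * Polynomial.C f.leadingCoeff⁻¹).natDegree * m with hn
  have hpow : (f * Polynomial.C f.leadingCoeff⁻¹) ^ m =
      Polynomial.derivative (Q * Polynomial.C c) := by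
    rw [mul_pow, ← Polynomial.C_pow, Polynomial.derivative_mul, hQ]
    simp [c]
  have hle : (Q * Polynomial.C c).natDegree < n + 2 := by
    refine Nat.lt_succ_of_le (Polynomial.natDegree_le_iff_coeff_eq_zero.mpr fun k hk => ?_)
    obtain ⟨k, rfl⟩ := Nat.exists_eq_add_of_lt (Nat.zero_lt_of_lt hk)
    have hcoeff : (Polynomial.derivative (Q * Polynomial.C c)).coeff k = 0 := by
      rw [← hpow]
      refine Polynomial.coeff_eq_zero_of_natDegree_lt ?_
      rw [hmonic.natDegree_pow, mul_comm, ← hn]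
      omega
    rw [Polynomial.coeff_derivative] at hcoeff
    simpa using (mul_eq_zero.mp hcoeff).resolve_right (by exact_mod_cast k.succ_ne_zero)
  have heval : (Q * Polynomial.C c).eval 1 - (Q * Polynomial.C c).eval 0 = 0 := by
    simp [hQe]
  rw [Polynomial.eval_eq_sum_range' hle, Finset.sum_range_succ',
    ← Polynomial.coeff_zero_eq_eval_zero] at heval
  simp only [one_pow, mul_one, add_sub_cancel_right] at heval
  rw [hpow, ← heval]
  refine Finset.sum_congr rfl fun k _ => ?_
  have hk : (k : K) + 1 ≠ 0 := by exact_mod_cast k.succ_ne_zero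
  rw [Polynomial.coeff_derivative, Algebra.smul_def]
  push_cast [map_inv₀, map_add, map_natCast, map_one]
  field_simp

/-- If all positive powers of `p` have integral zero over `[-r, r]`, where `r ≠ 0`, then
`p = 0`. -/
theorem eq_zero_of_forall_pow_eq_derivative_of_eval_neg {K : Type*} [Field K] [CharZero K]
    {p : Polynomial K} {r : K} (hr : r ≠ 0) (hp : ∀ m > 0, ∃ Q : Polynomial K,
      Polynomial.derivative Q = p ^ m ∧ Q.eval (-r) = Q.eval r) : p = 0 := by
  set L : Polynomial K := Polynomial.C (2 * r) * Polynomial.X - Polynomial.C r with hL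
  have h2r : 2 * r ≠ 0 := mul_ne_zero two_ne_zero hr
  have hcomp : p.comp L = 0 := by
    refine eq_zero_of_forall_pow_eq_derivative fun m hm => ?_
    obtain ⟨Q, hQ, hQe⟩ := hp m hm
    refine ⟨Polynomial.C (2 * r)⁻¹ * Q.comp L, ?_, ?_⟩
    · rw [Polynomial.derivative_C_mul, Polynomial.derivative_comp, hQ, ← Polynomial.pow_comp]
      have : Polynomial.derivative L = Polynomial.C (2 * r) := by simp [hL]
      rw [this, ← mul_assoc, ← Polynomial.C_mul, inv_mul_cancel₀ h2r, Polynomial.C_1, one_mul]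
    · have h0 : L.eval 0 = -r := by simp [hL]
      have h1 : L.eval 1 = r := by simp [hL]; ring
      simp [Polynomial.eval_comp, h0, h1, hQe]
  rcases Polynomial.comp_eq_zero_iff.mp hcomp with h | ⟨-, h⟩
  · exact h
  · have := congrArg (Polynomial.coeff · 1) h
    simp [hL, hr] at this

/-- Top weighted homogeneous components multiply. -/
theorem weightedHomogeneousComponent_mul_of_le {σ R M : Type*} [CommSemiring R]
    [AddCommMonoid M] [LinearOrder M] [IsOrderedCancelAddMonoid M] {w : σ → M}
    {P Q : MvPolynomial σ R} {a b : M} (hP : ∀ d ∈ P.support, Finsupp.weight w d ≤ a)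
    (hQ : ∀ d ∈ Q.support, Finsupp.weight w d ≤ b) :
    weightedHomogeneousComponent w (a + b) (P * Q) =
      weightedHomogeneousComponent w a P * weightedHomogeneousComponent w b Q := by
  classical
  ext d
  rw [coeff_weightedHomogeneousComponent, coeff_mul, coeff_mul]
  simp only [coeff_weightedHomogeneousComponent]
  trans ∑ x ∈ Finset.HasAntidiagonal.antidiagonal d,
      if Finsupp.weight w d = a + b then coeff x.1 P * coeff x.2 Q else 0
  · split_ifs <;> simp
  refine Finset.sum_congr rfl fun x hx => ?_
  by_cases h1 : coeff x.1 P = 0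
  · simp [h1]
  by_cases h2 : coeff x.2 Q = 0
  · simp [h2]
  rw [← Finset.HasAntidiagonal.mem_antidiagonal.mp hx, map_add]
  simp only [add_eq_add_iff_eq_and_eq (hP _ (mem_support_iff.mpr h1))
    (hQ _ (mem_support_iff.mpr h2))]
  split_ifs <;> simp_all

/-- The top weighted homogeneous component of a power. -/
theorem weightedHomogeneousComponent_pow_of_le {σ R M : Type*} [CommSemiring R]
    [AddCommMonoid M] [LinearOrder M] [IsOrderedCancelAddMonoid M] {w : σ → M}
    {P : MvPolynomial σ R} {a : M} (hP : ∀ d ∈ P.support, Finsupp.weight w d ≤ a) (n : ℕ) :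
    (∀ d ∈ (P ^ n).support, Finsupp.weight w d ≤ n • a) ∧
      weightedHomogeneousComponent w (n • a) (P ^ n) = weightedHomogeneousComponent w a P ^ n := by
  classical
  induction n with
  | zero =>
    refine ⟨fun d hd => ?_, ?_⟩
    · have : d = 0 := by
        by_contra h
        simp [coeff_one, Ne.symm h] at hd
      simp [this]
    · simpa using (isWeightedHomogeneous_one R w).weightedHomogeneousComponent_same
  | succ n ih =>
    refine ⟨fun d hd => ?_, ?_⟩
    · rw [pow_succ] at hd
      obtain ⟨x, hx, y, hy, rfl⟩ := Finset.mem_add.mp (support_mul _ _ hd)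
      rw [map_add, succ_nsmul]
      exact add_le_add (ih.1 x hx) (hP y hy)
    · rw [pow_succ, succ_nsmul, weightedHomogeneousComponent_mul_of_le ih.1 hP, ih.2, pow_succ]

/-- The weights `-1, 0, 1` of the three variables. -/
def omegaWeight : Fin 3 → ℤ := ![-1, 0, 1]

theorem weight_omegaWeight (d : Fin 3 →₀ ℕ) :
    Finsupp.weight omegaWeight d = -(d 0 : ℤ) + d 2 := by
  simp [Finsupp.weight_eq_sum, Fin.sum_univ_three, omegaWeight]

/-- The derivation `x₁ ∂_{x₂} - x₂ ∂_{x₃}`. -/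
noncomputable def basicDerivation (K : Type*) [Field K] :
    Derivation K (MvPolynomial (Fin 3) K) (MvPolynomial (Fin 3) K) :=
  (X 0 : MvPolynomial (Fin 3) K) • pderiv 1 - (X 1 : MvPolynomial (Fin 3) K) • pderiv 2

theorem basicDerivation_apply {K : Type*} [Field K] (u : MvPolynomial (Fin 3) K) :
    basicDerivation K u = X 0 * pderiv 1 u - X 1 * pderiv 2 u := rfl

theorem IsWeightedHomogeneous.basicDerivation {K : Type*} [Field K] {u : MvPolynomial (Fin 3) K}
    {n : ℤ} (hu : u.IsWeightedHomogeneous omegaWeight (n + 1)) :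
    (basicDerivation K u).IsWeightedHomogeneous omegaWeight n := by
  rw [basicDerivation_apply]
  refine (weightedHomogeneousSubmodule K omegaWeight n).sub_mem ?_ ?_
  · have h1 : (pderiv 1 u).IsWeightedHomogeneous omegaWeight (n + 1) :=
      hu.pderiv (by simp [omegaWeight])
    have h2 := (isWeightedHomogeneous_X K omegaWeight 0).mul h1
    simpa [omegaWeight] using h2
  · have h1 : (pderiv 2 u).IsWeightedHomogeneous omegaWeight n :=
      hu.pderiv (by simp [omegaWeight])
    have h2 := (isWeightedHomogeneous_X K omegaWeight 1).mul h1
    simpa [omegaWeight] using h2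

theorem weightedHomogeneousComponent_basicDerivation {K : Type*} [Field K]
    (u : MvPolynomial (Fin 3) K) (n : ℤ) :
    weightedHomogeneousComponent omegaWeight n (basicDerivation K u) =
      basicDerivation K (weightedHomogeneousComponent omegaWeight (n + 1) u) := by
  classical
  induction u using MvPolynomial.induction_on' with
  | add p q hp hq => simp only [map_add, hp, hq]
  | monomial d c =>
    have hd : (monomial d c : MvPolynomial (Fin 3) K).IsWeightedHomogeneous omegaWeight
        (Finsupp.weight omegaWeight d - 1 + 1) :=
      isWeightedHomogeneous_monomial _ _ _ (by ring)
    have hD := IsWeightedHomogeneous.basicDerivation hd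
    rcases eq_or_ne n (Finsupp.weight omegaWeight d - 1) with rfl | hn
    · rw [hd.weightedHomogeneousComponent_same, hD.weightedHomogeneousComponent_same]
    · rw [hd.weightedHomogeneousComponent_ne _ (fun h => hn (by linarith)),
        hD.weightedHomogeneousComponent_ne _ hn, map_zero]

theorem polynomial_eval_aeval {σ R : Type*} [CommSemiring R] (v : σ → Polynomial R)
    (t : R) (u : MvPolynomial σ R) :
    (aeval v u : Polynomial R).eval t = MvPolynomial.eval (fun i => (v i).eval t) u := by
  induction u using MvPolynomial.induction_on with
  | C a => simp
  | add p q hp hq => simp [hp, hq]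
  | mul_X p i hp => simp [hp]

/-- The substitution `x₁ ↦ 1/2`, `x₂ ↦ t`, `x₃ ↦ r² - t²`, which parametrizes a conic on the
quadric `x₂² + 2 x₁ x₃ = r²`. -/
noncomputable def conicSubst {K : Type*} [Field K] (r : K) :
    MvPolynomial (Fin 3) K →ₐ[K] Polynomial K :=
  aeval ![Polynomial.C 2⁻¹, Polynomial.X, Polynomial.C (r ^ 2) - Polynomial.X ^ 2]

theorem eval_conicSubst {K : Type*} [Field K] (r t : K) (u : MvPolynomial (Fin 3) K) :
    (conicSubst r u).eval t = eval ![2⁻¹, t, r ^ 2 - t ^ 2] u := by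
  rw [conicSubst, polynomial_eval_aeval]
  congr 2
  funext i
  fin_cases i <;> simp

theorem derivative_conicSubst {K : Type*} [Field K] [CharZero K] (r : K)
    (u : MvPolynomial (Fin 3) K) :
    Polynomial.derivative (conicSubst r u) =
      Polynomial.C 2 * conicSubst r (basicDerivation K u) := by
  induction u using MvPolynomial.induction_on with
  | C a => simp [conicSubst]
  | add p q hp hq => simp only [map_add, hp, hq, mul_add]
  | mul_X p i hp =>
    have hX : Polynomial.derivative (conicSubst r (X i)) =
        Polynomial.C 2 * conicSubst r (basicDerivation K (X i)) := by
      have h2 : (Polynomial.C 2 * Polynomial.C 2⁻¹ : Polynomial K) = 1 := by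
        rw [← Polynomial.C_mul, mul_inv_cancel₀ two_ne_zero, Polynomial.C_1]
      fin_cases i <;>
        simp [conicSubst, basicDerivation_apply, pderiv_X, h2, -map_pow, one_add_one_eq_two]
    rw [map_mul, Polynomial.derivative_mul, hp, hX, Derivation.leibniz, map_add, smul_eq_mul,
      smul_eq_mul, map_mul, map_mul]
    ring

theorem eval_conicSubst_eq_zero {K : Type*} [Field K] {r t : K} (ht : t ^ 2 = r ^ 2) {n : ℤ}
    (hn : 0 < n) {u : MvPolynomial (Fin 3) K} (hu : u.IsWeightedHomogeneous omegaWeight n) :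
    (conicSubst r u).eval t = 0 := by
  rw [eval_conicSubst, ht, sub_self, eval_eq']
  refine Finset.sum_eq_zero fun d hd => ?_
  have hw := hu (mem_support_iff.mp hd)
  rw [weight_omegaWeight] at hw
  have h2 : d 2 ≠ 0 := by omega
  simp [Fin.prod_univ_three, h2]

/-- A weighted homogeneous polynomial of nonnegative weight which vanishes on all the conics
vanishes. -/
theorem eq_zero_of_conicSubst_eq_zero {K : Type*} [Field K] [CharZero K] {n : ℕ}
    {g : MvPolynomial (Fin 3) K} (hg : g.IsWeightedHomogeneous omegaWeight (n : ℤ))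
    (h : ∀ r ≠ 0, conicSubst r g = 0) : g = 0 := by
  have hhalf : ∀ t z : K, eval ![2⁻¹, t, z] g = 0 := by
    intro t z
    set P : Polynomial K := aeval ![Polynomial.C 2⁻¹, Polynomial.C t, Polynomial.X] g with hP
    have hPe : ∀ z, P.eval z = eval ![2⁻¹, t, z] g := by
      intro z
      rw [hP, polynomial_eval_aeval]
      congr 2
      funext i
      fin_cases i <;> simp
    have hcomp : P.comp (Polynomial.X ^ 2 - Polynomial.C (t ^ 2)) = 0 := by
      refine Polynomial.eq_zero_of_infinite_isRoot _ ((Set.finite_singleton 0).infinite_compl.mono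
        fun r hr => ?_)
      have h0 := congrArg (Polynomial.eval t) (h r hr)
      rw [eval_conicSubst, Polynomial.eval_zero] at h0
      simp [Polynomial.IsRoot, Polynomial.eval_comp, hPe, h0]
    have hP0 : P = 0 := by
      rcases Polynomial.comp_eq_zero_iff.mp hcomp with h0 | ⟨-, h0⟩
      · exact h0
      · have := congrArg (Polynomial.coeff · 2) h0
        simp [-map_pow] at this
    rw [← hPe, hP0, Polynomial.eval_zero]
  have hmul : (C 2 * X 0) ^ n * g = 0 := by
    refine MvPolynomial.funext fun x => ?_
    rw [map_zero, ← hhalf (x 1) (2 * x 0 * x 2), map_mul, eval_eq' x g,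
      eval_eq' ![2⁻¹, x 1, 2 * x 0 * x 2] g, Finset.mul_sum]
    refine Finset.sum_congr rfl fun d hd => ?_
    have hw := hg (mem_support_iff.mp hd)
    rw [weight_omegaWeight] at hw
    have h2 : d 2 = d 0 + n := by omega
    have h3 : (2 : K) ^ d 0 * 2⁻¹ ^ d 0 = 1 := by
      rw [← mul_pow, mul_inv_cancel₀ two_ne_zero, one_pow]
    simp only [Fin.prod_univ_three, h2, map_pow, map_mul, eval_C, eval_X, Matrix.cons_val_zero,
      Matrix.cons_val_one, Matrix.cons_val, mul_pow, pow_add]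
    linear_combination
      (-2 ^ n * x 0 ^ n * x 0 ^ d 0 * x 1 ^ d 1 * x 2 ^ d 0 * x 2 ^ n * coeff d g) * h3
  refine (mul_eq_zero.mp hmul).resolve_left (pow_ne_zero _ (mul_ne_zero ?_ (X_ne_zero 0)))
  simp

theorem degOmega_neg_of_powers_mem_range_D
    {K : Type*} [Field K] [CharZero K]
    (D : MvPolynomial (Fin 3) K →ₗ[K] MvPolynomial (Fin 3) K)
    (hD : D = (LinearMap.mulLeft K (X 0)).comp (pderiv 1).toLinearMap
            - (LinearMap.mulLeft K (X 1)).comp (pderiv 2).toLinearMap)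
    (f : MvPolynomial (Fin 3) K)
    (hf : ∀ i : ℕ, 0 < i → f ^ i ∈ LinearMap.range D) :
    degOmega f < 0 := by
  classical
  have hDapp : ∀ u, D u = basicDerivation K u := fun u => by rw [hD]; rfl
  by_contra! hdeg
  have hne : f.support.Nonempty := by
    rw [Finset.nonempty_iff_ne_empty]
    intro h
    simp [degOmega, h] at hdeg
  obtain ⟨β, hβ, hmax⟩ := Finset.exists_max_image f.support (Finsupp.weight omegaWeight) hne
  obtain ⟨γ, hγ, hsup⟩ := Finset.exists_mem_eq_sup f.support hne
    fun β => ((-(β 0 : ℤ) + (β 2 : ℤ) : ℤ) : WithBot ℤ)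
  have hγ0 : 0 ≤ Finsupp.weight omegaWeight γ := by
    rw [degOmega, hsup] at hdeg
    rw [weight_omegaWeight]
    exact_mod_cast hdeg
  obtain ⟨n, hn⟩ := Int.eq_ofNat_of_zero_le (hγ0.trans (hmax γ hγ))
  rw [hn] at hmax
  set g := weightedHomogeneousComponent omegaWeight (n : ℤ) f with hg
  have hghom : g.IsWeightedHomogeneous omegaWeight (n : ℤ) :=
    weightedHomogeneousComponent_isWeightedHomogeneous _ _
  have hg0 : g ≠ 0 := by
    rw [MvPolynomial.ne_zero_iff]
    refine ⟨β, ?_⟩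
    rw [hg, coeff_weightedHomogeneousComponent, if_pos hn]
    exact mem_support_iff.mp hβ
  refine hg0 (eq_zero_of_conicSubst_eq_zero hghom fun r hr => ?_)
  refine eq_zero_of_forall_pow_eq_derivative_of_eval_neg hr fun m hm => ?_
  obtain ⟨u, hu⟩ := hf m hm
  set v := weightedHomogeneousComponent omegaWeight (m • (n : ℤ) + 1) u with hv
  have hgv : basicDerivation K v = g ^ m := by
    rw [hv, ← weightedHomogeneousComponent_basicDerivation, ← hDapp, hu,
      (weightedHomogeneousComponent_pow_of_le hmax m).2]
  have hvhom : v.IsWeightedHomogeneous omegaWeight (m • (n : ℤ) + 1) :=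
    weightedHomogeneousComponent_isWeightedHomogeneous _ _
  have hpos : 0 < m • (n : ℤ) + 1 := by positivity
  have heval : ∀ t, t ^ 2 = r ^ 2 → (conicSubst r v).eval t = 0 := fun t ht =>
    eval_conicSubst_eq_zero ht hpos hvhom
  refine ⟨Polynomial.C 2⁻¹ * conicSubst r v, ?_, ?_⟩
  · rw [Polynomial.derivative_C_mul, derivative_conicSubst, hgv, ← mul_assoc, ← Polynomial.C_mul,
      inv_mul_cancel₀ two_ne_zero, Polynomial.C_1, one_mul, map_pow]
  · simp [heval (-r) (neg_sq r), heval r rfl]
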